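/- Let β, β′ ∈ ℬ and let x ∈ 𝔰(β) with x ≠ 0. If β′ ≠ β, then Φ([x, e_{−β′}]) = 0. On the other hand, the element y = Φ([x, e_{−β}]) satisfies y ≠ 0 and y ∈ 𝔰(−β). -/

import Mathlib

open scoped InnerProductSpace BigOperators

structure RootSystemData (V : Type*) [NormedAddCommGroup V] [InnerProductSpace ℝ V] where
  Δ : Set V
  finite : Δ.Finite
  span_top : Submodule.span ℝ Δ = ⊤
  zero_not_mem : (0 : V) ∉ Δ
  neg_mem : ∀ α ∈ Δ, -α ∈ Δ
  reduced : ∀ α ∈ Δ, ∀ t : ℝ, t • α ∈ Δ → t = 1 ∨ t = -1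
  crystal : ∀ α ∈ Δ, ∀ β ∈ Δ, ∃ n : ℤ, 2 * ⟪α, β⟫_ℝ = (n : ℝ) * ⟪β, β⟫_ℝ
  reflect_mem : ∀ α ∈ Δ, ∀ β ∈ Δ, α - (2 * ⟪α, β⟫_ℝ / ⟪β, β⟫_ℝ) • β ∈ Δ
  Pos : Set V
  pos_subset : Pos ⊆ Δ
  mem_or_neg : ∀ α ∈ Δ, α ∈ Pos ∨ -α ∈ Pos
  not_neg_mem : ∀ α ∈ Pos, -α ∉ Pos
  pos_add : ∀ α ∈ Pos, ∀ β ∈ Pos, α + β ∈ Δ → α + β ∈ Pos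

namespace RootSystemData

variable {V : Type*} [NormedAddCommGroup V] [InnerProductSpace ℝ V] (R : RootSystemData V)

/-- The set of simple roots: indecomposable positive roots. -/
def Simple : Set V := {α ∈ R.Pos | ¬ ∃ β ∈ R.Pos, ∃ γ ∈ R.Pos, α = β + γ}

/-- The support `Π(φ)` of a positive root: the simple roots needed to express `φ`. -/
def support (φ : V) : Set V := {α ∈ R.Simple | φ ∉ Submodule.span ℝ (R.Simple \ {α})}

/-- The root subsystem `Δ(φ)`: all roots lying in the span of the support of `φ`. -/
def sub (φ : V) : Set V := {ψ ∈ R.Δ | ψ ∈ Submodule.span ℝ (R.support φ)}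

/-- The positive roots `Δ(φ)₊` of the subsystem `Δ(φ)`. -/
def posSub (φ : V) : Set V := R.sub φ ∩ R.Pos

/-- `x` is a nonnegative integer combination of positive roots. -/
def NonnegComb (x : V) : Prop :=
  ∃ c : V →₀ ℕ, ↑c.support ⊆ R.Pos ∧ x = c.sum fun α n => (n : ℝ) • α

/-- `β` is the highest root of the subset `S`. -/
def IsHighest (S : Set V) (β : V) : Prop :=
  β ∈ S ∧ β ∈ R.Pos ∧ ∀ ψ ∈ S, R.NonnegComb (β - ψ)

/-- `β` is locally high: it is the highest root of `Δ(β)`. -/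
def LocallyHigh (β : V) : Prop := β ∈ R.Pos ∧ R.IsHighest (R.sub β) β

/-- `E(β) = {φ ∈ Δ(β) : (φ,β) > 0}`. -/
def E (β : V) : Set V := {φ ∈ R.sub β | 0 < ⟪φ, β⟫_ℝ}

/-- `Δ(β)° = {φ ∈ Δ(β) : (φ,β) = 0}`. -/
def orth (β : V) : Set V := {φ ∈ R.sub β | ⟪φ, β⟫_ℝ = 0}

/-- Strong orthogonality of two roots. -/
def StronglyOrth (φ ψ : V) : Prop := φ + ψ ∉ R.Δ ∧ φ - ψ ∉ R.Δ


/-- Half the sum of the positive roots of `Δ(β)`. -/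
noncomputable def rho (β : V) : V := (2⁻¹ : ℝ) • ∑ᶠ φ ∈ R.posSub β, φ

/-- The dual Coxeter number of `Δ(β)`, `⟨ρ_β, β^∨⟩ + 1`. -/
noncomputable def dualCoxeter (β : V) : ℝ := 2 * ⟪R.rho β, β⟫_ℝ / ⟪β, β⟫_ℝ + 1

end RootSystemData

/-- A finite set of vectors is irreducible if it is nonempty and admits no splitting into
two nonempty mutually orthogonal pieces. -/
def IsIrred {V : Type*} [NormedAddCommGroup V] [InnerProductSpace ℝ V] (S : Set V) : Prop :=
  S.Nonempty ∧ ¬ ∃ A B : Set V, A ∪ B = S ∧ A ∩ B = ∅ ∧ A.Nonempty ∧ B.Nonempty ∧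
    ∀ a ∈ A, ∀ b ∈ B, ⟪a, b⟫_ℝ = 0

/-- `C` is an irreducible component of `S`. -/
def IsComponent {V : Type*} [NormedAddCommGroup V] [InnerProductSpace ℝ V]
    (S C : Set V) : Prop :=
  C ⊆ S ∧ IsIrred C ∧ ∀ a ∈ C, ∀ b ∈ S \ C, ⟪a, b⟫_ℝ = 0

/-- The reflection `s_β` in the (co)vector `β`. -/
noncomputable def reflectRoot {V : Type*} [NormedAddCommGroup V] [InnerProductSpace ℝ V]
    (β v : V) : V := v - (2 * ⟪v, β⟫_ℝ / ⟪β, β⟫_ℝ) • β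

namespace RootSystemData

variable {V : Type*} [NormedAddCommGroup V] [InnerProductSpace ℝ V] (R : RootSystemData V)

/-- A chain cascade: a nonempty list whose head is the highest root of an irreducible
component of `Δ`, and each subsequent entry is the highest root of an irreducible component
of `Δ(previous)°`. -/
def IsChainCascade (l : List V) : Prop :=
  l ≠ [] ∧
  (∀ b ∈ l.head?, ∃ C, IsComponent R.Δ C ∧ R.IsHighest C b) ∧
  l.Chain' fun γ δ => ∃ C, IsComponent (R.orth γ) C ∧ R.IsHighest C δ

/-- The cascade `ℬ` of roots: all positive roots belonging to some chain cascade. -/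
def cascade : Set V := {β | ∃ l, R.IsChainCascade l ∧ β ∈ l}

/-- `l` is the chain cascade `C(φ)` associated to the positive root `φ`. -/
def IsCascadeChainOf (φ : V) (l : List V) : Prop :=
  R.IsChainCascade l ∧ (∀ β ∈ l, φ ∈ R.sub β) ∧
  (∀ β ∈ l.dropLast, ⟪φ, β⟫_ℝ = 0) ∧ ∀ β ∈ l.getLast?, 0 < ⟪φ, β⟫_ℝ

end RootSystemData

section LieSetup

variable (V : Type*) [NormedAddCommGroup V] [InnerProductSpace ℝ V]
  (L : Type*) [LieRing L] [LieAlgebra ℂ L] [Module.Finite ℂ L]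

/-- A triangular decomposition of a finite-dimensional complex semisimple Lie algebra `L`,
with Cartan subalgebra `H`, root system `Δ` (realized in the real inner product space `V`,
the inner product being the one induced by the Killing form), chosen root vectors `e φ`,
and the projection `Φ : L → 𝔫₋` with kernel `𝔟 = 𝔥 ⊕ 𝔫`. -/
structure CascadeLieData extends RootSystemData V where
  /-- the root vectors `e_φ` -/
  e : V → L
  /-- the Cartan subalgebra `𝔥` -/
  H : LieSubalgebra ℂ L
  /-- the realization of `V` inside `𝔥*`: each `φ ∈ V` gives a functional on `𝔥` -/
  wt : V →ₗ[ℝ] (H →ₗ[ℂ] ℂ)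
  wt_inj : Function.Injective wt
  e_ne : ∀ φ ∈ Δ, e φ ≠ 0
  indep : LinearIndependent ℂ fun φ : Δ => e (φ : V)
  root_vec : ∀ x : H, ∀ φ ∈ Δ, ⁅(x : L), e φ⁆ = wt φ x • e φ
  bracket_add : ∀ φ ∈ Δ, ∀ ψ ∈ Δ, φ + ψ ∈ Δ →
    ∃ c : ℂ, c ≠ 0 ∧ ⁅e φ, e ψ⁆ = c • e (φ + ψ)
  bracket_zero : ∀ φ ∈ Δ, ∀ ψ ∈ Δ, φ + ψ ∉ Δ → φ + ψ ≠ 0 → ⁅e φ, e ψ⁆ = 0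
  bracket_opp : ∀ φ ∈ Δ, ⁅e φ, e (-φ)⁆ ∈ H
  span_eq_top : H.toSubmodule ⊔ Submodule.span ℂ (e '' Δ) = ⊤
  killing_pair : ∀ φ ∈ Δ, killingForm ℂ L (e φ) (e (-φ)) ≠ 0
  killing_orth : ∀ φ ∈ Δ, ∀ ψ ∈ Δ, φ + ψ ≠ 0 → killingForm ℂ L (e φ) (e ψ) = 0
  /-- the projection `Φ : 𝔤 → 𝔫₋` with kernel `𝔟` -/
  Φ : L →ₗ[ℂ] L
  Φ_neg : ∀ z ∈ Submodule.span ℂ (e '' (Neg.neg '' Pos)), Φ z = z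
  Φ_b : ∀ z ∈ H.toSubmodule ⊔ Submodule.span ℂ (e '' Pos), Φ z = 0

end LieSetup

namespace CascadeLieData

variable {V : Type*} [NormedAddCommGroup V] [InnerProductSpace ℝ V]
  {L : Type*} [LieRing L] [LieAlgebra ℂ L] [Module.Finite ℂ L]
  (C : CascadeLieData V L)

/-- The nilradical `𝔫 = ⊕_{φ∈Δ₊} 𝔤_φ`. -/
def nSub : Submodule ℂ L := Submodule.span ℂ (C.e '' C.Pos)

/-- The opposite nilradical `𝔫₋`. -/
def nMinus : Submodule ℂ L := Submodule.span ℂ (C.e '' (Neg.neg '' C.Pos))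

/-- The Borel subalgebra `𝔟 = 𝔥 ⊕ 𝔫` (as a subspace). -/
def bSub : Submodule ℂ L := C.H.toSubmodule ⊔ C.nSub

/-- `𝔯 = span{e_β : β ∈ ℬ}`. -/
def rSub : Submodule ℂ L := Submodule.span ℂ (C.e '' C.toRootSystemData.cascade)

/-- `𝔯₋ = span{e_{−β} : β ∈ ℬ}`. -/
def rMinus : Submodule ℂ L :=
  Submodule.span ℂ (C.e '' (Neg.neg '' C.toRootSystemData.cascade))

/-- `𝔯₋ˣ`: the elements of `𝔯₋` all of whose coefficients are nonzero. -/
def rMinusX : Set L :=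
  {z | ∃ a : V → ℂ, (∀ β ∈ C.toRootSystemData.cascade, a β ≠ 0) ∧
    z = ∑ᶠ β ∈ C.toRootSystemData.cascade, a β • C.e (-β)}

/-- `𝔰 = span{e_φ : φ ∈ Δ₊ \ ℬ}`. -/
def sSub : Submodule ℂ L :=
  Submodule.span ℂ (C.e '' (C.Pos \ C.toRootSystemData.cascade))

/-- `𝔰₋ = span{e_{−φ} : φ ∈ Δ₊ \ ℬ}`. -/
def sMinus : Submodule ℂ L :=
  Submodule.span ℂ (C.e '' (Neg.neg '' (C.Pos \ C.toRootSystemData.cascade)))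

/-- `𝔰(β) = span{e_φ : φ ∈ E(β), φ ≠ β}`. -/
def sBeta (β : V) : Submodule ℂ L :=
  Submodule.span ℂ (C.e '' (C.toRootSystemData.E β \ {β}))

/-- `𝔰(−β) = span{e_{−φ} : φ ∈ E(β), φ ≠ β}`. -/
def sBetaMinus (β : V) : Submodule ℂ L :=
  Submodule.span ℂ (C.e '' (Neg.neg '' (C.toRootSystemData.E β \ {β})))

/-- `𝔢(β) = span{e_φ : φ ∈ E(β)}`. -/
def eSub (β : V) : Submodule ℂ L := Submodule.span ℂ (C.e '' C.toRootSystemData.E β)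

/-- `𝔤(β)`: the Lie subalgebra generated by the root spaces `𝔤_{±α}`, `α ∈ Π(β)`. -/
def gSub (β : V) : LieSubalgebra ℂ L :=
  LieSubalgebra.lieSpan ℂ L
    (C.e '' C.toRootSystemData.support β ∪ C.e '' (Neg.neg '' C.toRootSystemData.support β))

end CascadeLieData

namespace RootSystemData

variable {V : Type*} [NormedAddCommGroup V] [InnerProductSpace ℝ V] {R : RootSystemData V}

lemma ne_zero_of_mem {α : V} (hα : α ∈ R.Δ) : α ≠ 0 :=
  fun h => R.zero_not_mem (h ▸ hα)

lemma inner_self_pos {α : V} (hα : α ∈ R.Δ) : 0 < ⟪α, α⟫_ℝ :=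
  real_inner_self_pos.2 (ne_zero_of_mem hα)

lemma sub_smul_mem {α β : V} (hα : α ∈ R.Δ) (hβ : β ∈ R.Δ) {t : ℝ}
    (ht : 2 * ⟪α, β⟫_ℝ = t * ⟪β, β⟫_ℝ) : α - t • β ∈ R.Δ := by
  have h := R.reflect_mem α hα β hβ
  rwa [ht, mul_div_cancel_right₀ _ (inner_self_pos hβ).ne'] at h

lemma sub_mem_of_inner_pos {α β : V} (hα : α ∈ R.Δ) (hβ : β ∈ R.Δ)
    (hpos : 0 < ⟪α, β⟫_ℝ) (hne : α ≠ β) : α - β ∈ R.Δ := by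
  obtain ⟨n, hn⟩ := R.crystal α hα β hβ
  obtain ⟨m, hm⟩ := R.crystal β hβ α hα
  have ha := inner_self_pos hα
  have hb := inner_self_pos hβ
  by_cases hn1 : n = 1
  · simpa [hn1] using sub_smul_mem hα hβ hn
  by_cases hm1 : m = 1
  · simpa [hm1] using R.neg_mem _ (sub_smul_mem hβ hα hm)
  exfalso
  rw [real_inner_comm] at hm
  have hn0 : (0 : ℝ) < n := pos_of_mul_pos_left (hn ▸ by positivity) hb.le
  have hm0 : (0 : ℝ) < m := pos_of_mul_pos_left (hm ▸ by positivity) ha.le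
  have hn2 : (2 : ℝ) ≤ n := by
    have : 0 < n := by exact_mod_cast hn0
    exact_mod_cast (by omega : 2 ≤ n)
  have hm2 : (2 : ℝ) ≤ m := by
    have : 0 < m := by exact_mod_cast hm0
    exact_mod_cast (by omega : 2 ≤ m)
  have h0 : ⟪α - β, α - β⟫_ℝ ≤ 0 := by
    rw [inner_sub_left, inner_sub_right, inner_sub_right, real_inner_comm α β]
    nlinarith
  exact hne (sub_eq_zero.1 (real_inner_self_nonpos.1 h0))

lemma add_mem_of_inner_neg {α β : V} (hα : α ∈ R.Δ) (hβ : β ∈ R.Δ)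
    (hneg : ⟪α, β⟫_ℝ < 0) (hne : α + β ≠ 0) : α + β ∈ R.Δ := by
  have h := sub_mem_of_inner_pos hα (R.neg_mem β hβ) (by rw [inner_neg_right]; linarith)
    (fun h => hne (by rw [h, neg_add_cancel]))
  simpa using h

lemma add_ne_zero_of_pos {α β : V} (hα : α ∈ R.Pos) (hβ : β ∈ R.Pos) : α + β ≠ 0 :=
  fun h => R.not_neg_mem α hα (by rwa [neg_eq_of_add_eq_zero_right h])

lemma add_nsmul_mem_pos {α : V} (hα : α ∈ R.Pos) (k : ℕ) :
    ∀ φ ∈ R.Pos, 2 * ⟪φ, α⟫_ℝ = -(k : ℝ) * ⟪α, α⟫_ℝ → φ + (k : ℝ) • α ∈ R.Pos := by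
  have haΔ := R.pos_subset hα
  have ha := inner_self_pos haΔ
  induction k using Nat.twoStepInduction with
  | zero => intro φ hφ _; simpa using hφ
  | one =>
    intro φ hφ h
    have h' := sub_smul_mem (R.pos_subset hφ) haΔ h
    simp only [Nat.cast_one, neg_smul, one_smul, sub_neg_eq_add] at h' ⊢
    exact R.pos_add _ hφ _ hα h'
  | more k ih _ =>
    intro φ hφ h
    push_cast at h ⊢
    have hneg : ⟪φ, α⟫_ℝ < 0 := by nlinarith [(Nat.cast_nonneg k : (0 : ℝ) ≤ k)]
    have h1 : φ + α ∈ R.Pos := R.pos_add _ hφ _ hα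
      (add_mem_of_inner_neg (R.pos_subset hφ) haΔ hneg (add_ne_zero_of_pos hφ hα))
    have h2 := ih _ h1 (by rw [inner_add_left]; linarith)
    have h3 := sub_smul_mem (R.pos_subset hφ) haΔ h
    have e : φ + α + (k : ℝ) • α + α = φ + ((k : ℝ) + 2) • α := by module
    rw [← e]
    refine R.pos_add _ h2 _ hα ?_
    rw [e]
    simpa only [neg_smul, sub_neg_eq_add] using h3

lemma inner_pos_of_reflectRoot_notMem {α φ : V} (hα : α ∈ R.Pos) (hφ : φ ∈ R.Pos)
    (h : reflectRoot α φ ∉ R.Pos) : 0 < ⟪φ, α⟫_ℝ := by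
  by_contra! hle
  have ha := inner_self_pos (R.pos_subset hα)
  obtain ⟨n, hn⟩ := R.crystal φ (R.pos_subset hφ) α (R.pos_subset hα)
  have hn0 : n ≤ 0 := by
    by_contra! hc
    have : (0 : ℝ) < n := by exact_mod_cast hc
    nlinarith
  obtain ⟨k, hk⟩ := Int.eq_ofNat_of_zero_le (neg_nonneg.2 hn0)
  have hk' : (n : ℝ) = -(k : ℝ) := by
    rw [← neg_neg n, hk]; push_cast; rfl
  rw [hk'] at hn
  apply h
  have := add_nsmul_mem_pos hα k φ hφ hn
  rwa [reflectRoot, hn, mul_div_cancel_right₀ _ ha.ne', neg_smul, sub_neg_eq_add]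

lemma inner_reflectRoot {α : V} (hα : α ∈ R.Δ) (φ : V) :
    ⟪reflectRoot α φ, α⟫_ℝ = -⟪φ, α⟫_ℝ := by
  have ha := (inner_self_pos hα).ne'
  rw [reflectRoot, inner_sub_left, inner_smul_left]
  simp only [conj_trivial]
  field_simp
  ring

lemma reflectRoot_reflectRoot {α : V} (hα : α ∈ R.Δ) (φ : V) :
    reflectRoot α (reflectRoot α φ) = φ := by
  rw [reflectRoot, inner_reflectRoot hα, reflectRoot]
  module

variable (R) in
/-- Some linear functional (pairing with the sum of the positive roots) is positive on all
positive roots. -/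
lemma exists_height : ∃ h : Module.Dual ℝ V, ∀ α ∈ R.Pos, 0 < h α := by
  classical
  have hfin : R.Pos.Finite := R.finite.subset R.pos_subset
  refine ⟨innerₗ V (∑ φ ∈ hfin.toFinset, φ), fun α hα => ?_⟩
  have hαΔ := R.pos_subset hα
  rw [innerₗ_apply_apply, sum_inner,
    ← Finset.sum_filter_add_sum_filter_not _ (fun φ => reflectRoot α φ ∈ R.Pos)]
  have h0 : ∑ φ ∈ hfin.toFinset with reflectRoot α φ ∈ R.Pos, ⟪φ, α⟫_ℝ = 0 := by
    refine Finset.sum_involution (fun φ _ => reflectRoot α φ) ?_ ?_ ?_ ?_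
    · intro φ _
      rw [inner_reflectRoot hαΔ, add_neg_cancel]
    · intro φ _ hne heq
      have := inner_reflectRoot hαΔ φ
      rw [heq] at this
      exact hne (by linarith)
    · intro φ hφ
      simp only [Finset.mem_filter, Set.Finite.mem_toFinset] at hφ ⊢
      exact ⟨hφ.2, by rw [reflectRoot_reflectRoot hαΔ]; exact hφ.1⟩
    · intro φ _
      exact reflectRoot_reflectRoot hαΔ φ
  rw [h0, zero_add]
  apply Finset.sum_pos
  · intro φ hφ
    simp only [Finset.mem_filter, Set.Finite.mem_toFinset] at hφ
    exact inner_pos_of_reflectRoot_notMem hα hφ.1 hφ.2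
  · refine ⟨α, ?_⟩
    simp only [Finset.mem_filter, Set.Finite.mem_toFinset]
    refine ⟨hα, fun hmem => R.not_neg_mem α hα ?_⟩
    have e : reflectRoot α α = -α := by
      rw [reflectRoot, mul_div_assoc, div_self (inner_self_pos hαΔ).ne']
      module
    rwa [e] at hmem

lemma support_subset_of_mem_sub {β γ : V} (hβ : β ∈ R.sub γ) : R.support β ⊆ R.support γ := by
  rintro α ⟨hα, hspan⟩
  by_contra hn
  refine hspan (Submodule.span_mono ?_ hβ.2)
  exact fun δ hδ => ⟨hδ.1, fun e => hn (e ▸ hδ)⟩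

lemma support_subset_sub (β : V) : R.support β ⊆ R.sub β :=
  fun _ hα => ⟨R.pos_subset hα.1.1, Submodule.subset_span hα⟩

lemma neg_mem_sub {β φ : V} (hφ : φ ∈ R.sub β) : -φ ∈ R.sub β :=
  ⟨R.neg_mem _ hφ.1, Submodule.neg_mem _ hφ.2⟩

lemma sub_mem_sub {β φ ψ : V} (hφ : φ ∈ R.sub β) (hψ : ψ ∈ R.sub β) (h : φ - ψ ∈ R.Δ) :
    φ - ψ ∈ R.sub β :=
  ⟨h, sub_mem hφ.2 hψ.2⟩

variable (R) in
/-- A set of roots closed under sums and differences which contains `Δ(β)` for each of its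
positive elements `β`. -/
structure IsParabolic (S : Set V) : Prop where
  subset : S ⊆ R.Δ
  add_mem : ∀ φ ∈ S, ∀ ψ ∈ S, φ + ψ ∈ R.Δ → φ + ψ ∈ S
  sub_mem : ∀ φ ∈ S, ∀ ψ ∈ S, φ - ψ ∈ R.Δ → φ - ψ ∈ S
  sub_subset : ∀ β ∈ S, β ∈ R.Pos → R.sub β ⊆ S

lemma isParabolic_roots : R.IsParabolic R.Δ where
  subset := subset_rfl
  add_mem _ _ _ _ h := h
  sub_mem _ _ _ _ h := h
  sub_subset _ _ _ _ h := h.1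

lemma _root_.IsComponent.eq_or_disjoint {S C₁ C₂ : Set V} (h₁ : IsComponent S C₁)
    (h₂ : IsComponent S C₂) : C₁ = C₂ ∨ Disjoint C₁ C₂ := by
  have aux : ∀ {A B : Set V}, IsComponent S A → IsComponent S B → (A ∩ B).Nonempty → A ⊆ B := by
    intro A B hA hB hAB
    by_contra hne
    refine hA.2.1.2 ⟨A ∩ B, A \ B, Set.inter_union_sdiff A B, ?_, hAB,
      Set.nonempty_of_not_subset hne, fun a ha b hb => hB.2.2 a ha.2 b ⟨hA.1 hb.1, hb.2⟩⟩
    ext x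
    simp only [Set.mem_inter_iff, Set.mem_sdiff, Set.mem_empty_iff_false]
    tauto
  by_cases hne : (C₁ ∩ C₂).Nonempty
  · exact Or.inl ((aux h₁ h₂ hne).antisymm (aux h₂ h₁ (Set.inter_comm C₁ C₂ ▸ hne)))
  · exact Or.inr (Set.disjoint_iff_inter_eq_empty.2 (Set.not_nonempty_iff_eq_empty.1 hne))

/-- `β` is reached from `S` by repeatedly passing to highest roots of irreducible components
and to their orthogonal subsystems. -/
inductive Reaches (R : RootSystemData V) : Set V → V → Prop
  | base {S C : Set V} {β : V} (hC : IsComponent S C) (hβ : R.IsHighest C β) : Reaches R S β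
  | step {S C : Set V} {γ β : V} (hC : IsComponent S C) (hγ : R.IsHighest C γ)
      (hβ : Reaches R (R.orth γ) β) : Reaches R S β

lemma reaches_of_mem_chain (l : List V) : ∀ (S : Set V) (γ β : V),
    (∃ C, IsComponent S C ∧ R.IsHighest C γ) →
    (γ :: l).IsChain (fun γ δ => ∃ C, IsComponent (R.orth γ) C ∧ R.IsHighest C δ) →
    β ∈ γ :: l → R.Reaches S β := by
  induction l with
  | nil =>
    rintro S γ β ⟨C, hC, hγ⟩ - hβ
    rw [List.mem_singleton.1 hβ]
    exact .base hC hγ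
  | cons δ l ih =>
    rintro S γ β ⟨C, hC, hγ⟩ hl hβ
    rw [List.isChain_cons_cons] at hl
    rcases List.mem_cons.1 hβ with rfl | hβ
    · exact .base hC hγ
    · exact .step hC hγ (ih _ _ _ hl.1 hl.2 hβ)

lemma reaches_of_mem_cascade {β : V} (hβ : β ∈ R.cascade) : R.Reaches R.Δ β := by
  obtain ⟨l, ⟨hne, hhead, hl⟩, hmem⟩ := hβ
  cases l with
  | nil => exact absurd rfl hne
  | cons γ l => exact reaches_of_mem_chain l _ γ β (hhead γ rfl) hl hmem

lemma sub_notMem_pos_of_disjoint {S C₁ C₂ : Set V} (hS : R.IsParabolic S)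
    (h₁ : IsComponent S C₁) (h₂ : IsComponent S C₂) (hd : Disjoint C₁ C₂) {φ β : V}
    (hφ : φ ∈ C₁) (hβ : β ∈ C₂) : β - φ ∉ R.Δ := by
  intro hψ
  have hψS := hS.sub_mem _ (h₂.1 hβ) _ (h₁.1 hφ) hψ
  have hβφ : ⟪β, φ⟫_ℝ = 0 :=
    h₂.2.2 β hβ φ ⟨h₁.1 hφ, fun hm => Set.disjoint_left.1 hd hφ hm⟩
  by_cases hm : β - φ ∈ C₁
  · have h0 := h₂.2.2 β hβ _ ⟨hψS, fun hm' => Set.disjoint_left.1 hd hm hm'⟩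
    rw [inner_sub_right, hβφ, sub_zero] at h0
    exact (inner_self_pos (hS.subset (h₂.1 hβ))).ne' h0
  · have h0 := h₁.2.2 φ hφ _ ⟨hψS, hm⟩
    rw [inner_sub_right, real_inner_comm, hβφ, zero_sub, neg_eq_zero] at h0
    exact (inner_self_pos (hS.subset (h₁.1 hφ))).ne' h0

variable {h : Module.Dual ℝ V} (hh : ∀ α ∈ R.Pos, 0 < h α)
include hh

lemma mem_pos_of_height_pos {φ : V} (hφ : φ ∈ R.Δ) (hpos : 0 < h φ) : φ ∈ R.Pos := by
  rcases R.mem_or_neg φ hφ with h1 | h1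
  · exact h1
  · have := hh _ h1
    rw [map_neg] at this
    linarith

lemma NonnegComb.height {x : V} (hx : R.NonnegComb x) : 0 ≤ h x ∧ (h x = 0 → x = 0) := by
  obtain ⟨c, hc, rfl⟩ := hx
  have hnn : ∀ α ∈ c.support, 0 ≤ (c α : ℝ) * h α := fun α hα =>
    mul_nonneg (Nat.cast_nonneg _) (hh α (hc hα)).le
  have e : h (c.sum fun α n => (n : ℝ) • α) = ∑ α ∈ c.support, (c α : ℝ) * h α := by
    simp [Finsupp.sum, map_sum]
  rw [e]
  refine ⟨Finset.sum_nonneg hnn, fun h0 => ?_⟩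
  rw [Finset.sum_eq_zero_iff_of_nonneg hnn] at h0
  refine Finset.sum_eq_zero fun α hα => ?_
  rcases mul_eq_zero.1 (h0 α hα) with h1 | h1
  · simp [h1]
  · exact absurd h1 (hh α (hc hα)).ne'

lemma IsHighest.height_le {S : Set V} {β ψ : V} (hβ : R.IsHighest S β) (hψ : ψ ∈ S) :
    h ψ ≤ h β := by
  have := ((hβ.2.2 ψ hψ).height hh).1
  rw [map_sub] at this
  linarith

lemma IsHighest.eq_of_height_eq {S : Set V} {β ψ : V} (hβ : R.IsHighest S β) (hψ : ψ ∈ S)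
    (he : h ψ = h β) : ψ = β := by
  have := ((hβ.2.2 ψ hψ).height hh).2 (by rw [map_sub, he, sub_self])
  exact (sub_eq_zero.1 this).symm

lemma linearIndepOn_simple : LinearIndepOn ℝ id R.Simple := by
  refine LinearMap.BilinForm.linearIndependent_of_pairwise_le_zero (innerₗ V) ?_ h _
    (fun i => hh _ i.2.1) ?_
  · intro x hx
    simpa [LinearMap.BilinMap.toQuadraticMap_apply, sq_pos_iff] using hx
  · rintro ⟨α, hα⟩ ⟨β, hβ⟩ hne
    simp only [innerₗ_apply_apply, id]
    by_contra! hpos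
    have hne' : α ≠ β := fun h => hne (Subtype.ext h)
    have hmem := sub_mem_of_inner_pos (R.pos_subset hα.1) (R.pos_subset hβ.1) hpos hne'
    rcases R.mem_or_neg _ hmem with h1 | h1
    · exact hα.2 ⟨_, h1, _, hβ.1, by abel⟩
    · exact hβ.2 ⟨_, h1, _, hα.1, by abel⟩

lemma exists_simple_sum {φ : V} (hφ : φ ∈ R.Pos) :
    ∃ c : V →₀ ℝ, (∀ α, 0 ≤ c α) ∧ ↑c.support ⊆ R.Simple ∧
      φ = Finsupp.linearCombination ℝ id c := by
  by_contra hbad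
  have hfin : {φ ∈ R.Pos | ¬ ∃ c : V →₀ ℝ, (∀ α, 0 ≤ c α) ∧ ↑c.support ⊆ R.Simple ∧
      φ = Finsupp.linearCombination ℝ id c}.Finite :=
    (R.finite.subset R.pos_subset).subset fun _ h => h.1
  obtain ⟨ψ, ⟨hψ, hψbad⟩, hmin⟩ := Set.exists_min_image _ h hfin ⟨φ, hφ, hbad⟩
  have key : ∀ γ ∈ R.Pos, h γ < h ψ → ∃ c : V →₀ ℝ, (∀ α, 0 ≤ c α) ∧
      ↑c.support ⊆ R.Simple ∧ γ = Finsupp.linearCombination ℝ id c := by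
    intro γ hγ hlt
    by_contra hc
    exact absurd (hmin γ ⟨hγ, hc⟩) (not_le.2 hlt)
  by_cases hs : ψ ∈ R.Simple
  · refine hψbad ⟨Finsupp.single ψ 1, fun α => ?_, ?_, by simp⟩
    · by_cases e : ψ = α <;> simp [e]
    · refine (Finset.coe_subset.2 Finsupp.support_single_subset).trans ?_
      simpa using hs
  · obtain ⟨γ, hγ, δ, hδ, rfl⟩ : ∃ β ∈ R.Pos, ∃ γ ∈ R.Pos, ψ = β + γ := by
      by_contra hc
      exact hs ⟨hψ, hc⟩
    have h1 := hh γ hγ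
    have h2 := hh δ hδ
    obtain ⟨c, hc0, hcs, hc⟩ := key γ hγ (by rw [map_add]; linarith)
    obtain ⟨d, hd0, hds, hd⟩ := key δ hδ (by rw [map_add]; linarith)
    classical
    refine hψbad ⟨c + d, fun α => add_nonneg (hc0 α) (hd0 α), ?_, by rw [map_add, ← hc, ← hd]⟩
    intro α hα
    rcases Finset.mem_union.1 (Finsupp.support_add hα) with h3 | h3
    · exact hcs h3
    · exact hds h3

lemma support_linearCombination {c : V →₀ ℝ} (hc : ↑c.support ⊆ R.Simple) :
    R.support (Finsupp.linearCombination ℝ id c) = c.support := by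
  classical
  ext α
  have hsplit : Finsupp.linearCombination ℝ id c =
      c α • α + Finsupp.linearCombination ℝ id (c.erase α) := by
    conv_lhs => rw [← Finsupp.single_add_erase α c]
    simp
  have hmem : Finsupp.linearCombination ℝ id (c.erase α) ∈
      Submodule.span ℝ (R.Simple \ {α}) := by
    rw [Finsupp.linearCombination_apply]
    refine Submodule.sum_mem _ fun β hβ => Submodule.smul_mem _ _ (Submodule.subset_span ?_)
    rw [Finsupp.support_erase, Finset.mem_erase] at hβ
    exact ⟨hc hβ.2, hβ.1⟩
  constructor
  · rintro ⟨-, hα⟩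
    simp only [Finset.mem_coe, Finsupp.mem_support_iff]
    intro h0
    rw [hsplit, h0, zero_smul, zero_add] at hα
    exact hα hmem
  · intro hα
    refine ⟨hc hα, fun hspan => ?_⟩
    rw [hsplit, Submodule.add_mem_iff_left _ hmem,
      Submodule.smul_mem_iff _ (Finsupp.mem_support_iff.1 hα)] at hspan
    have := (linearIndepOn_simple hh).notMem_span (hc hα)
    simp only [Set.image_id', id] at this
    exact this hspan

lemma mem_span_support {β : V} (hβ : β ∈ R.Pos) : β ∈ Submodule.span ℝ (R.support β) := by
  obtain ⟨c, -, hcs, hc⟩ := exists_simple_sum hh hβ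
  have hs := support_linearCombination hh hcs
  rw [← hc] at hs
  rw [hs, hc, Finsupp.linearCombination_apply]
  exact Submodule.sum_mem _ fun α hα => Submodule.smul_mem _ _ (Submodule.subset_span hα)

lemma mem_sub_self {β : V} (hβ : β ∈ R.Pos) : β ∈ R.sub β :=
  ⟨R.pos_subset hβ, mem_span_support hh hβ⟩

lemma IsHighest.unique {S : Set V} {β γ : V} (hβ : R.IsHighest S β) (hγ : R.IsHighest S γ) :
    β = γ :=
  hγ.eq_of_height_eq hh hβ.1 ((hγ.height_le hh hβ.1).antisymm (hβ.height_le hh hγ.1))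

lemma IsHighest.sub_subset {S C : Set V} {β : V} (hS : R.IsParabolic S) (hC : IsComponent S C)
    (hβ : R.IsHighest C β) : R.sub β ⊆ C := by
  classical
  have hβS := hS.sub_subset β (hC.1 hβ.1) hβ.2.1
  obtain ⟨c, hc0, hcs, hc⟩ := exists_simple_sum hh hβ.2.1
  have hs := support_linearCombination hh hcs
  rw [← hc] at hs
  have hsupp : R.support β ⊆ C := by
    rw [hs]
    set a := ∑ α ∈ c.support with α ∈ C, c α • α with ha
    set b := ∑ α ∈ c.support with α ∉ C, c α • α with hb
    have hab : β = a + b := by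
      rw [ha, hb, Finset.sum_filter_add_sum_filter_not, hc, Finsupp.linearCombination_apply]
      rfl
    have horth : ∀ γ ∈ C, ⟪γ, b⟫_ℝ = 0 := by
      intro γ hγ
      rw [hb, inner_sum]
      refine Finset.sum_eq_zero fun α hα => ?_
      rw [Finset.mem_filter] at hα
      rw [inner_smul_right, hC.2.2 γ hγ α
        ⟨hβS (support_subset_sub β (by rw [hs]; exact hα.1)), hα.2⟩, mul_zero]
    have hab0 : ⟪a, b⟫_ℝ = 0 := by
      rw [ha, sum_inner]
      refine Finset.sum_eq_zero fun α hα => ?_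
      rw [inner_smul_left, horth α (Finset.mem_filter.1 hα).2, mul_zero]
    have hb0 : b = 0 := by
      have h0 := horth β hβ.1
      rw [hab, inner_add_left, hab0, zero_add] at h0
      exact inner_self_eq_zero.1 h0
    have hhb : ∑ α ∈ c.support with α ∉ C, c α * h α = 0 := by
      have := congrArg h hb0
      simpa [hb, map_sum] using this
    intro α hα
    by_contra hαC
    have hpos : ∀ δ ∈ c.support, 0 < c δ * h δ := fun δ hδ =>
      mul_pos ((hc0 δ).lt_of_ne' (Finsupp.mem_support_iff.1 hδ)) (hh δ (hcs hδ).1)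
    rw [Finset.sum_eq_zero_iff_of_nonneg
      fun δ hδ => (hpos δ (Finset.mem_filter.1 hδ).1).le] at hhb
    exact (hpos α hα).ne' (hhb α (Finset.mem_filter.2 ⟨hα, hαC⟩))
  intro ψ hψ
  by_contra hψC
  have hle : Submodule.span ℝ (R.support β) ≤ LinearMap.ker (innerₗ V ψ) := by
    rw [Submodule.span_le]
    intro α hα
    simpa [real_inner_comm] using hC.2.2 α (hsupp hα) ψ ⟨hβS hψ, hψC⟩
  have := hle hψ.2
  rw [LinearMap.mem_ker, innerₗ_apply_apply] at this
  exact (inner_self_pos hψ.1).ne' this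

lemma IsHighest.locallyHigh {S C : Set V} {β : V} (hS : R.IsParabolic S) (hC : IsComponent S C)
    (hβ : R.IsHighest C β) : R.LocallyHigh β :=
  ⟨hβ.2.1, mem_sub_self hh hβ.2.1, hβ.2.1,
    fun ψ hψ => hβ.2.2 ψ (hβ.sub_subset hh hS hC hψ)⟩

lemma LocallyHigh.add_notMem {β ψ : V} (hβ : R.LocallyHigh β) (hψ : ψ ∈ R.Pos)
    (hψβ : ψ ∈ R.sub β) : β + ψ ∉ R.Δ := by
  intro hm
  have := hβ.2.height_le hh (ψ := β + ψ) ⟨hm, add_mem hβ.2.1.2 hψβ.2⟩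
  rw [map_add] at this
  linarith [hh ψ hψ]

lemma LocallyHigh.inner_nonneg {β ψ : V} (hβ : R.LocallyHigh β) (hψ : ψ ∈ R.Pos)
    (hψβ : ψ ∈ R.sub β) : 0 ≤ ⟪ψ, β⟫_ℝ := by
  by_contra! hneg
  rw [real_inner_comm] at hneg
  exact hβ.add_notMem hh hψ hψβ (add_mem_of_inner_neg (R.pos_subset hβ.1) hψβ.1 hneg
    (add_ne_zero_of_pos hβ.1 hψ))

lemma LocallyHigh.pos_of_mem_E {β φ : V} (hβ : R.LocallyHigh β) (hφ : φ ∈ R.E β) :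
    φ ∈ R.Pos := by
  rcases R.mem_or_neg φ hφ.1.1 with h1 | h1
  · exact h1
  · have := hβ.inner_nonneg hh h1 (neg_mem_sub hφ.1)
    rw [inner_neg_left] at this
    linarith [hφ.2]

lemma LocallyHigh.isParabolic_orth {γ : V} (hγ : R.LocallyHigh γ) :
    R.IsParabolic (R.orth γ) where
  subset _ h := h.1.1
  add_mem φ hφ ψ hψ hm :=
    ⟨⟨hm, add_mem hφ.1.2 hψ.1.2⟩, by rw [inner_add_left, hφ.2, hψ.2, add_zero]⟩
  sub_mem φ hφ ψ hψ hm :=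
    ⟨⟨hm, _root_.sub_mem hφ.1.2 hψ.1.2⟩, by rw [inner_sub_left, hφ.2, hψ.2, sub_zero]⟩
  sub_subset β hβ hβpos := by
    obtain ⟨c, hc0, hcs, hc⟩ := exists_simple_sum hh hβpos
    have hs := support_linearCombination hh hcs
    rw [← hc] at hs
    have hsub := support_subset_of_mem_sub hβ.1
    have hnn : ∀ α ∈ c.support, 0 ≤ c α * ⟪α, γ⟫_ℝ := fun α hα =>
      mul_nonneg (hc0 α) (hγ.inner_nonneg hh (hcs hα).1
        (support_subset_sub γ (hsub (by rw [hs]; exact hα))))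
    have hsum : ∑ α ∈ c.support, c α * ⟪α, γ⟫_ℝ = 0 := by
      have h0 := hβ.2
      rw [hc, Finsupp.linearCombination_apply, Finsupp.sum, sum_inner] at h0
      simpa [inner_smul_left] using h0
    rw [Finset.sum_eq_zero_iff_of_nonneg hnn] at hsum
    have hle : Submodule.span ℝ (R.support β) ≤ LinearMap.ker (innerₗ V γ) := by
      rw [Submodule.span_le, hs]
      intro α hα
      have := (mul_eq_zero.1 (hsum α hα)).resolve_left (Finsupp.mem_support_iff.1 hα)
      simpa [real_inner_comm] using this
    intro ψ hψ
    refine ⟨⟨hψ.1, Submodule.span_mono hsub hψ.2⟩, ?_⟩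
    have := hle hψ.2
    rwa [LinearMap.mem_ker, innerₗ_apply_apply, real_inner_comm] at this

lemma Reaches.mem {S : Set V} {β : V} (hβ : R.Reaches S β) (hS : R.IsParabolic S) :
    β ∈ S ∧ R.LocallyHigh β := by
  induction hβ with
  | base hC hβ => exact ⟨hC.1 hβ.1, hβ.locallyHigh hh hS hC⟩
  | step hC hγ _ ih =>
    have hγ' := hγ.locallyHigh hh hS hC
    have := ih (hγ'.isParabolic_orth hh)
    exact ⟨hC.1 (hγ.sub_subset hh hS hC this.1.1), this.2⟩

lemma Reaches.exists_component {S : Set V} {β : V} (hβ : R.Reaches S β)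
    (hS : R.IsParabolic S) : ∃ C γ, IsComponent S C ∧ R.IsHighest C γ ∧ R.sub β ⊆ C ∧
      (β = γ ∨ R.Reaches (R.orth γ) β) := by
  cases hβ with
  | base hC hβ => exact ⟨_, _, hC, hβ, hβ.sub_subset hh hS hC, Or.inl rfl⟩
  | step hC hγ hβ =>
    have hpar := (hγ.locallyHigh hh hS hC).isParabolic_orth hh
    have hm := hβ.mem hh hpar
    exact ⟨_, _, hC, hγ, fun ψ hψ =>
      hγ.sub_subset hh hS hC (hpar.sub_subset _ hm.1 hm.2.1 hψ).1, Or.inr hβ⟩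

/-- The trichotomy for two distinct members of the cascade. -/
lemma Reaches.trichotomy {S : Set V} {β β' : V} (hβ : R.Reaches S β) (hS : R.IsParabolic S)
    (hβ' : R.Reaches S β') (hne : β' ≠ β) :
    β' ∈ R.orth β ∨ β ∈ R.orth β' ∨ ∃ S C₁ C₂, R.IsParabolic S ∧ IsComponent S C₁ ∧
      IsComponent S C₂ ∧ Disjoint C₁ C₂ ∧ R.sub β ⊆ C₁ ∧ R.sub β' ⊆ C₂ := by
  induction hβ with
  | @base S C β hC hβ =>
    obtain ⟨C', γ', hC', hγ', hsub', hor⟩ := hβ'.exists_component hh hS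
    rcases hC.eq_or_disjoint hC' with rfl | hd
    · rw [hγ'.unique hh hβ] at hor
      refine Or.inl ?_
      exact ((hor.resolve_left hne).mem hh ((hβ.locallyHigh hh hS hC).isParabolic_orth hh)).1
    · exact Or.inr (Or.inr ⟨S, C, C', hS, hC, hC', hd, hβ.sub_subset hh hS hC, hsub'⟩)
  | @step S C γ β hC hγ hβ ih =>
    obtain ⟨C', γ', hC', hγ', hsub', hor⟩ := hβ'.exists_component hh hS
    have hpar := (hγ.locallyHigh hh hS hC).isParabolic_orth hh
    have hm := hβ.mem hh hpar
    rcases hC.eq_or_disjoint hC' with rfl | hd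
    · rw [hγ'.unique hh hγ] at hor
      rcases hor with rfl | hor
      · exact Or.inr (Or.inl hm.1)
      · exact ih hpar hor hne
    · exact Or.inr (Or.inr ⟨S, C, C', hS, hC, hC', hd, fun ψ hψ =>
        hγ.sub_subset hh hS hC (hpar.sub_subset _ hm.1 hm.2.1 hψ).1, hsub'⟩)

omit hh

lemma locallyHigh_of_mem_cascade {β : V} (hβ : β ∈ R.cascade) : R.LocallyHigh β := by
  obtain ⟨h, hh⟩ := R.exists_height
  exact ((reaches_of_mem_cascade hβ).mem hh isParabolic_roots).2

lemma sub_notMem_pos_of_mem_E {β β' φ : V} (hβ : β ∈ R.cascade) (hβ' : β' ∈ R.cascade)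
    (hne : β' ≠ β) (hφ : φ ∈ R.E β) : β' - φ ∉ R.Pos := by
  obtain ⟨h, hh⟩ := R.exists_height
  have hlh := locallyHigh_of_mem_cascade hβ
  have hlh' := locallyHigh_of_mem_cascade hβ'
  intro hψ
  have hψΔ := R.pos_subset hψ
  rcases (reaches_of_mem_cascade hβ).trichotomy hh isParabolic_roots
    (reaches_of_mem_cascade hβ') hne with ho | ho | ⟨S, C₁, C₂, hS, h₁, h₂, hd, hs, hs'⟩
  · have := hlh.inner_nonneg hh hψ (sub_mem_sub ho.1 hφ.1 hψΔ)
    rw [inner_sub_left, ho.2] at this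
    linarith [hφ.2]
  · have hφ' := (hlh'.isParabolic_orth hh).sub_subset β ho hlh.1 hφ.1
    refine hlh'.add_notMem hh (hlh.pos_of_mem_E hh hφ) hφ'.1 ?_
    have hr := sub_smul_mem hψΔ hlh'.2.1.1 (t := 2)
      (by rw [inner_sub_left, hφ'.2, sub_zero])
    have := R.neg_mem _ hr
    rwa [show -(β' - φ - (2 : ℝ) • β') = β' + φ by module] at this
  · exact sub_notMem_pos_of_disjoint hS h₁ h₂ hd (hs hφ.1) (hs' hlh'.2.1) hψΔ

lemma LocallyHigh.sub_mem_pos_and_mem_E {β φ : V} (hβ : R.LocallyHigh β)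
    (hφ : φ ∈ R.E β \ {β}) : β - φ ∈ R.Pos ∧ β - φ ∈ R.E β \ {β} := by
  obtain ⟨h, hh⟩ := R.exists_height
  obtain ⟨hφ, hne : φ ≠ β⟩ := hφ
  have hβΔ := R.pos_subset hβ.1
  have hb := inner_self_pos hβΔ
  have hle := hβ.2.height_le hh hφ.1
  have hlt : h φ < h β := hle.lt_of_ne fun e => hne (hβ.2.eq_of_height_eq hh hφ.1 e)
  have hmem : β - φ ∈ R.Δ := by
    simpa using R.neg_mem _ (sub_mem_of_inner_pos hφ.1.1 hβΔ hφ.2 hne)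
  have hpos : β - φ ∈ R.Pos := mem_pos_of_height_pos hh hmem (by rw [map_sub]; linarith)
  refine ⟨hpos, ⟨sub_mem_sub hβ.2.1 hφ.1 hmem, ?_⟩, ?_⟩
  · obtain ⟨n, hn⟩ := R.crystal φ hφ.1.1 β hβΔ
    have hn2 : (n : ℝ) < 2 := by
      have hr := R.neg_mem _ (sub_smul_mem hφ.1.1 hβΔ hn)
      have := hβ.2.height_le hh (ψ := -(φ - (n : ℝ) • β))
        ⟨hr, Submodule.neg_mem _ (_root_.sub_mem hφ.1.2 (Submodule.smul_mem _ _ hβ.2.1.2))⟩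
      simp only [map_neg, map_sub, map_smul, smul_eq_mul] at this
      have hβpos := hh β hβ.1
      nlinarith
    have hn1 : (n : ℝ) ≤ 1 := by
      have : n < 2 := by exact_mod_cast hn2
      exact_mod_cast (by omega : n ≤ 1)
    rw [inner_sub_left]
    nlinarith
  · intro e
    exact ne_zero_of_mem hφ.1.1 (by simpa using (e : β - φ = β))

end RootSystemData

namespace CascadeLieData

variable {V : Type*} [NormedAddCommGroup V] [InnerProductSpace ℝ V]
  {L : Type*} [LieRing L] [LieAlgebra ℂ L]
  (C : CascadeLieData V L)

/-- The linear map `x ↦ Φ([x, e_{−β}])`. -/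
def projBracket (β : V) : L →ₗ[ℂ] L :=
  -(C.Φ ∘ₗ (LieAlgebra.ad ℂ L (C.e (-β)) : L →ₗ[ℂ] L))

lemma projBracket_apply (β : V) (x : L) : C.projBracket β x = C.Φ ⁅x, C.e (-β)⁆ := by
  rw [projBracket, LinearMap.neg_apply, LinearMap.comp_apply, LieAlgebra.ad_apply, ← map_neg,
    lie_skew]

variable {C}

lemma projBracket_eq_zero {β φ : V} (hβ : β ∈ C.Δ) (hφ : φ ∈ C.Δ) (hm : β - φ ∉ C.Pos) :
    C.projBracket β (C.e φ) = 0 := by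
  rw [projBracket_apply]
  by_cases he : φ = β
  · subst he
    exact C.Φ_b _ (Submodule.mem_sup_left (C.bracket_opp _ hφ))
  by_cases hΔ : φ + -β ∈ C.Δ
  · obtain ⟨c, -, hc⟩ := C.bracket_add φ hφ _ (C.neg_mem β hβ) hΔ
    rw [hc]
    refine C.Φ_b _ (Submodule.mem_sup_right (Submodule.smul_mem _ _ (Submodule.subset_span
      ⟨_, (C.mem_or_neg _ hΔ).resolve_right fun hn => hm ?_, rfl⟩)))
    simpa [sub_eq_add_neg] using hn
  · rw [C.bracket_zero φ hφ _ (C.neg_mem β hβ) hΔ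
      (fun h0 => he (by rwa [← sub_eq_add_neg, sub_eq_zero] at h0)), map_zero]

lemma projBracket_eq_smul {β φ : V} (hβ : β ∈ C.Δ) (hφ : φ ∈ C.Δ) (hm : β - φ ∈ C.Pos) :
    ∃ c : ℂ, c ≠ 0 ∧ C.projBracket β (C.e φ) = c • C.e (-(β - φ)) := by
  have e : -(β - φ) = φ + -β := by abel
  have hΔ : φ + -β ∈ C.Δ := e ▸ C.neg_mem _ (C.pos_subset hm)
  obtain ⟨c, hc0, hc⟩ := C.bracket_add φ hφ _ (C.neg_mem β hβ) hΔ
  refine ⟨c, hc0, ?_⟩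
  rw [projBracket_apply, hc, ← e]
  exact C.Φ_neg _ (Submodule.smul_mem _ _ (Submodule.subset_span ⟨_, ⟨_, hm, rfl⟩, rfl⟩))

lemma linearIndepOn_projBracket {β : V} (hβ : C.toRootSystemData.LocallyHigh β) :
    LinearIndepOn ℂ (fun φ => C.projBracket β (C.e φ)) (C.toRootSystemData.E β \ {β}) := by
  have hβΔ := C.pos_subset hβ.1
  have hE : ∀ φ : ↥(C.toRootSystemData.E β \ {β}), ∃ c : ℂˣ,
      C.projBracket β (C.e φ) = c • C.e (-(β - φ)) := by
    intro φ
    obtain ⟨c, hc0, hc⟩ := projBracket_eq_smul hβΔ φ.2.1.1.1 (hβ.sub_mem_pos_and_mem_E φ.2).1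
    exact ⟨Units.mk0 c hc0, hc⟩
  choose c hc using hE
  let g : ↥(C.toRootSystemData.E β \ {β}) → C.Δ := fun φ =>
    ⟨-(β - φ), C.neg_mem _ (C.pos_subset (hβ.sub_mem_pos_and_mem_E φ.2).1)⟩
  have hg : Function.Injective g := fun φ ψ e => by
    have : -(β - (φ : V)) = -(β - (ψ : V)) := congrArg Subtype.val e
    exact Subtype.ext (by simpa using this)
  have := (C.indep.comp g hg).units_smul c
  rw [LinearIndepOn]
  convert this using 1
  funext φ
  exact hc φ

end CascadeLieData

/-- Let `β, β′ ∈ ℬ` and `0 ≠ x ∈ 𝔰(β)`.  If `β′ ≠ β` then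
`Φ([x, e_{−β′}]) = 0`, while `y = Φ([x, e_{−β}])` satisfies `y ≠ 0` and `y ∈ 𝔰(−β)`. -/
theorem statement11 {V : Type*} [NormedAddCommGroup V] [InnerProductSpace ℝ V]
    {L : Type*} [LieRing L] [LieAlgebra ℂ L] [Module.Finite ℂ L]
    (C : CascadeLieData V L) (β β' : V)
    (hβ : β ∈ C.toRootSystemData.cascade) (hβ' : β' ∈ C.toRootSystemData.cascade)
    (x : L) (hx : x ∈ C.sBeta β) (hx0 : x ≠ 0) :
    (β' ≠ β → C.Φ ⁅x, C.e (-β')⁆ = 0) ∧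
    C.Φ ⁅x, C.e (-β)⁆ ≠ 0 ∧ C.Φ ⁅x, C.e (-β)⁆ ∈ C.sBetaMinus β := by
  have hlh := RootSystemData.locallyHigh_of_mem_cascade hβ
  have hβΔ := C.pos_subset hlh.1
  refine ⟨fun hne => ?_, fun h0 => ?_, ?_⟩
  · rw [← C.projBracket_apply]
    have hle : C.sBeta β ≤ LinearMap.ker (C.projBracket β') := by
      refine Submodule.span_le.2 ?_
      rintro _ ⟨φ, hφ, rfl⟩
      exact CascadeLieData.projBracket_eq_zero
        (C.pos_subset (RootSystemData.locallyHigh_of_mem_cascade hβ').1) hφ.1.1.1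
        (RootSystemData.sub_notMem_pos_of_mem_E hβ hβ' hne hφ.1)
    exact hle hx
  · rw [← C.projBracket_apply] at h0
    obtain ⟨l, hl, rfl⟩ := (Finsupp.mem_span_image_iff_linearCombination ℂ).1 hx
    rw [Finsupp.apply_linearCombination] at h0
    have := linearIndepOn_iff.1 (CascadeLieData.linearIndepOn_projBracket hlh) l hl h0
    exact hx0 (by rw [this, map_zero])
  · rw [← C.projBracket_apply]
    have hle : C.sBeta β ≤ (C.sBetaMinus β).comap (C.projBracket β) := by
      refine Submodule.span_le.2 ?_
      rintro _ ⟨φ, hφ, rfl⟩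
      have hm := hlh.sub_mem_pos_and_mem_E hφ
      obtain ⟨c, -, hc⟩ := CascadeLieData.projBracket_eq_smul hβΔ hφ.1.1.1 hm.1
      change C.projBracket β (C.e φ) ∈ C.sBetaMinus β
      rw [hc]
      exact Submodule.smul_mem _ _ (Submodule.subset_span ⟨_, ⟨_, hm.2, rfl⟩, rfl⟩)
    exact hle hx
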